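/- arXiv:2602.14634 — 4 statements merged into one kernel-verified Lean document; each statement's English description precedes it below -/
import Mathlib

section
/- Correctness of projected lemma enumeration (Algorithm 3 with the baseline enumerator): suppose that no total assignment ν satisfies simultaneously F ν = true, ν ∘ Sum.inr ≠ η ∘ Sum.inr for every η ∈ H(F), and C ν = true for every C ∈ Cl (i.e., F conjoined with all blocking clauses of BC_T(F) and all clauses of Cl is propositionally unsatisfiable). Then Cl rules out P(F). -/
/-- correctness of projected lemma enumeration: if `F` conjoined with
all blocking clauses of `BC_T(F)` and all clauses of `Cl` is propositionally
unsatisfiable, then `Cl` rules out `P(F)`. -/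
theorem stmt11 {αB αT : Type*} (F : (αB ⊕ αT → Bool) → Bool)
    (SatT : (αT → Bool) → Prop) (Cl : Set ((αB ⊕ αT → Bool) → Bool))
    (hunsat : ¬ ∃ ν : αB ⊕ αT → Bool, F ν = true ∧
        (∀ η : αB ⊕ αT → Bool, (F η = true ∧ SatT (η ∘ Sum.inr)) →
            ν ∘ Sum.inr ≠ η ∘ Sum.inr) ∧
        (∀ C ∈ Cl, C ν = true)) :
    ∀ ρ : αB ⊕ αT → Bool, (F ρ = true ∧ ¬ SatT (ρ ∘ Sum.inr)) →
      ∃ C ∈ Cl, C ρ = false := by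
  rintro ρ ⟨hF, hρ⟩
  by_contra! h
  refine hunsat ⟨ρ, hF, fun η hη heq => hρ (heq ▸ hη.2), fun C hC => ?_⟩
  simpa using h C hC
end

section
/- Correctness of divide-and-conquer lemma enumeration: let {μ_i}_{i ∈ ι} be a family of partial assignments such that every total assignment ν with F ν = true extends some μ_i, let K₀ be a set of clauses, and for each i let F_i be the truth function whose value at ν is true iff F ν = true, ν extends μ_i, and C ν = true for every C ∈ K₀. If, for every i, the set K_i rules out P(F_i), then K₀ ∪ ⋃_{i ∈ ι} K_i rules out P(F). -/
/-- correctness of divide-and-conquer lemma enumeration: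
if the partial assignments `μ i` cover all propositional models of `F`, and for
each `i` the set `K i` rules out `P(F_i)` (where `F_i` is `F` restricted to
extensions of `μ i` satisfying all clauses of `K₀`), then `K₀ ∪ ⋃ i, K i`
rules out `P(F)`. -/
theorem stmt13 {α ι : Type*} (F : (α → Bool) → Bool) (Sat : (α → Bool) → Prop)
    (μ : ι → α → Option Bool)
    (K₀ : Set ((α → Bool) → Bool)) (K : ι → Set ((α → Bool) → Bool))
    (hcov : ∀ ν : α → Bool, F ν = true → ∃ i : ι, ∀ a b, μ i a = some b → ν a = b)
    (hK : ∀ i : ι, ∀ ρ : α → Bool,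
        ((F ρ = true ∧ (∀ a b, μ i a = some b → ρ a = b) ∧ ∀ C ∈ K₀, C ρ = true) ∧
          ¬ Sat ρ) →
        ∃ C ∈ K i, C ρ = false) :
    ∀ ρ : α → Bool, (F ρ = true ∧ ¬ Sat ρ) →
      ∃ C ∈ K₀ ∪ ⋃ i : ι, K i, C ρ = false := by
  rintro ρ ⟨hF, hS⟩
  by_cases h : ∃ C ∈ K₀, C ρ = false
  · obtain ⟨C, hC, hCρ⟩ := h
    exact ⟨C, Or.inl hC, hCρ⟩
  · obtain ⟨i, hi⟩ := hcov ρ hF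
    have h₀ : ∀ C ∈ K₀, C ρ = true := fun C hC =>
      Bool.eq_true_of_not_eq_false fun hf => h ⟨C, hC, hf⟩
    obtain ⟨C, hC, hCρ⟩ := hK i ρ ⟨⟨hF, hi, h₀⟩, hS⟩
    exact ⟨C, Or.inr (Set.mem_iUnion.2 ⟨i, hC⟩), hCρ⟩
end

section
/- Property 1 (theory-driven partitioning of satisfiability): for every total truth assignment η on α = α₁ ⊕ α₂, η is satisfiable (some valuation realizes η on all atoms of α) if and only if the restriction of η to α₁ is satisfiable (some valuation realizes it on the atoms of α₁) and the restriction of η to α₂ is satisfiable (some valuation realizes it on the atoms of α₂). -/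
/-- Property 1, theory-driven partitioning of satisfiability:
a total assignment on `α₁ ⊕ α₂` is satisfiable iff its restrictions to `α₁`
and to `α₂` are both satisfiable, provided the atoms of `α₁` depend only on the
variables `V₁` and those of `α₂` only on `V₂`, with `V₁` and `V₂` disjoint. -/
theorem stmt14 {D V α₁ α₂ : Type*} (V₁ V₂ : Set V) (hdisj : Disjoint V₁ V₂)
    (A₁ : α₁ → (V → D) → Prop) (A₂ : α₂ → (V → D) → Prop)
    (hdep₁ : ∀ (a : α₁) (v v' : V → D), (∀ x ∈ V₁, v x = v' x) → (A₁ a v ↔ A₁ a v'))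
    (hdep₂ : ∀ (a : α₂) (v v' : V → D), (∀ x ∈ V₂, v x = v' x) → (A₂ a v ↔ A₂ a v')) :
    ∀ η : α₁ ⊕ α₂ → Bool,
      (∃ v : V → D, (∀ a : α₁, A₁ a v ↔ η (Sum.inl a) = true) ∧
          (∀ a : α₂, A₂ a v ↔ η (Sum.inr a) = true)) ↔
      ((∃ v : V → D, ∀ a : α₁, A₁ a v ↔ η (Sum.inl a) = true) ∧
       (∃ v : V → D, ∀ a : α₂, A₂ a v ↔ η (Sum.inr a) = true)) := by
  classical
  intro η
  constructor
  · rintro ⟨v, h₁, h₂⟩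
    exact ⟨⟨v, h₁⟩, ⟨v, h₂⟩⟩
  · rintro ⟨⟨v₁, h₁⟩, ⟨v₂, h₂⟩⟩
    refine ⟨V₁.piecewise v₁ v₂, fun a => ?_, fun a => ?_⟩
    · exact (hdep₁ a _ v₁ fun x hx => Set.piecewise_eq_of_mem _ _ _ hx).trans (h₁ a)
    · exact (hdep₂ a _ v₂ fun x hx =>
        Set.piecewise_eq_of_notMem _ _ _ (Set.disjoint_right.mp hdisj hx)).trans (h₂ a)
end

section
/- Generalization of the partitioning theorem to n partitions (correctness of the partitioning-based enumerator): let Cl₁, ..., Cl_n be sets of clauses and define F₁ := F and F_{k+1} := F_k ∧ ⋀Cl_k for 1 ≤ k < n. If, for every k with 1 ≤ k ≤ n, BC_k(F_k) ∪ Cl_k rules out P(F_k), then Cl₁ ∪ ... ∪ Cl_n rules out P(F). -/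
/-- generalization of the partitioning theorem to `n` partitions:
with `F_k := F ∧ ⋀_{j<k} Cl_j`, if for every `k` the set `BC_k(F_k) ∪ Cl_k`
rules out `P(F_k)`, then `⋃ k, Cl_k` rules out `P(F)`. -/
theorem stmt17 {n : ℕ} {β : Fin n → Type*}
    (F : ((Σ i : Fin n, β i) → Bool) → Bool)
    (SatC : ∀ i : Fin n, (β i → Bool) → Prop)
    (Cl : Fin n → Set (((Σ i : Fin n, β i) → Bool) → Bool))
    -- `proj i ν` is the i-th projection of ν; `Fk k` is the truth function
    -- `F ∧ ⋀_{j < k} Cl_j` (so `Fk 0 = F₁ = F`).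
    (h : ∀ k : Fin n, ∀ ρ : (Σ i : Fin n, β i) → Bool,
        ((F ρ = true ∧ ∀ j : Fin n, j < k → ∀ C ∈ Cl j, C ρ = true) ∧
          ¬ (∀ i : Fin n, SatC i (fun b => ρ ⟨i, b⟩))) →
        (∃ η : (Σ i : Fin n, β i) → Bool,
            ((F η = true ∧ ∀ j : Fin n, j < k → ∀ C ∈ Cl j, C η = true) ∧
              (∀ i : Fin n, SatC i (fun b => η ⟨i, b⟩))) ∧
            (fun b => ρ ⟨k, b⟩) = (fun b => η ⟨k, b⟩)) ∨
        (∃ C ∈ Cl k, C ρ = false)) :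
    ∀ ρ : (Σ i : Fin n, β i) → Bool,
      (F ρ = true ∧ ¬ (∀ i : Fin n, SatC i (fun b => ρ ⟨i, b⟩))) →
      ∃ C ∈ ⋃ k : Fin n, Cl k, C ρ = false := by
  rintro ρ ⟨hF, hρ⟩
  by_contra! hC
  have hCl : ∀ k, ∀ C ∈ Cl k, C ρ = true := fun k C hk =>
    Bool.eq_true_of_not_eq_false (hC C (Set.mem_iUnion.2 ⟨k, hk⟩))
  refine hρ fun k => ?_
  rcases h k ρ ⟨⟨hF, fun j _ => hCl j⟩, hρ⟩ with ⟨η, ⟨-, hη⟩, hproj⟩ | ⟨C, hk, hCρ⟩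
  · rw [hproj]
    exact hη k
  · exact absurd hCρ (hC C (Set.mem_iUnion.2 ⟨k, hk⟩))
end
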